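/- Fix a prime p and a perfect field k of characteristic p, and let 𝔖 = W(k)[[u]]. Let M be a finitely generated 𝔖-module killed by p^n which admits a resolution 0 → 𝔖^d → 𝔖^d → M → 0 by finite free 𝔖-modules, and let N ⊆ M be a submodule. Then the following are equivalent: (1) N is saturated in M, i.e. for every m ∈ M, if u·m ∈ N then m ∈ N (equivalently, N is the contraction to M of its image in M[1/u]); (2) both N and the quotient M/N admit resolutions 0 → 𝔖^{a} → 𝔖^{a} → · → 0 by finite free 𝔖-modules (i.e. both have projective dimension at most 1). -/

import Mathlib

/-- An `R`-module `M` admits a two-term resolution `0 → R^a → R^a → M → 0`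
by finite free modules. -/
def HasTwoTermFreeResolution (R : Type*) [CommRing R]
    (M : Type*) [AddCommGroup M] [Module R M] : Prop :=
  ∃ (a : ℕ) (f : (Fin a → R) →ₗ[R] (Fin a → R)) (g : (Fin a → R) →ₗ[R] M),
    Function.Injective f ∧ Function.Surjective g ∧ LinearMap.range f = LinearMap.ker g

open scoped Pointwise in
/-- Over a domain `R` with a prime element `x` in its Jacobson radical such that `R ⧸ (x)` is a
principal ideal ring, the kernel of a map from a finite free module to an `x`-torsion-free module
is free, provided it is finitely presented. -/
theorem free_ker_of_isSMulRegular {R : Type*} [CommRing R] [IsDomain R] {x : R} (hx : Prime x)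
    (hjac : x ∈ (⊥ : Ideal R).jacobson) [IsPrincipalIdealRing (R ⧸ Ideal.span {x})]
    {L : Type*} [AddCommGroup L] [Module R L] (hL : IsSMulRegular L x) {ι : Type*}
    (g : (ι → R) →ₗ[R] L) [Module.FinitePresentation R (LinearMap.ker g)] :
    Module.Free R (LinearMap.ker g) := by
  have : (Ideal.span {x}).IsPrime := (Ideal.span_singleton_prime hx.ne_zero).2 hx
  have : Module.Finite (R ⧸ Ideal.span {x}) (QuotSMulTop x (LinearMap.ker g)) :=
    Module.Finite.of_restrictScalars_finite R _ _
  have : Module.IsTorsionFree (R ⧸ Ideal.span {x}) (QuotSMulTop x (LinearMap.ker g)) := by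
    refine ⟨fun r hr ↦ isSMulRegular_iff_right_eq_zero_of_smul.2 fun m hm ↦ ?_⟩
    obtain ⟨r, rfl⟩ := Ideal.Quotient.mk_surjective r
    obtain ⟨m, rfl⟩ := Submodule.Quotient.mk_surjective _ m
    have hxr : ¬ x ∣ r := fun h ↦
      hr.ne_zero (Ideal.Quotient.eq_zero_iff_mem.2 (Ideal.mem_span_singleton.2 h))
    have hm' : r • m ∈ x • (⊤ : Submodule R (LinearMap.ker g)) :=
      (Submodule.Quotient.mk_eq_zero _).1 hm
    obtain ⟨y, -, hy⟩ := (Submodule.mem_smul_pointwise_iff_exists _ _ _).1 hm'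
    have hdvd (i : ι) : x ∣ m.1 i := by
      have h : x * y.1 i = r * m.1 i := congr_fun (congr_arg Subtype.val hy) i
      exact (hx.dvd_or_dvd (h ▸ dvd_mul_right x (y.1 i))).resolve_left hxr
    choose z hz using hdvd
    have hmz : m.1 = x • z := funext hz
    have hgz : g z = 0 := hL.right_eq_zero_of_smul (by rw [← map_smul, ← hmz, m.2])
    refine (Submodule.Quotient.mk_eq_zero _).2
      ((Submodule.mem_smul_pointwise_iff_exists _ _ _).2 ⟨⟨z, hgz⟩, trivial, Subtype.ext hmz.symm⟩)
  exact (Module.free_quotSMulTop_iff_free R (LinearMap.ker g) hjac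
    (.of_injective (LinearMap.ker g).subtype (Submodule.subtype_injective _)
      (isSMulRegular_iff_right_eq_zero_of_smul.2 fun v hv ↦
        (smul_eq_zero.1 hv).resolve_left hx.ne_zero))).1 inferInstance

/-- A finite `x`-torsion-free module killed by a nonzero element has a two-term finite free
resolution, if `x` is a prime element in the Jacobson radical with principal ideal quotient. -/
theorem HasTwoTermFreeResolution.of_isSMulRegular {R : Type*} [CommRing R] [IsDomain R]
    [IsNoetherianRing R] {x : R} (hx : Prime x) (hjac : x ∈ (⊥ : Ideal R).jacobson)
    [IsPrincipalIdealRing (R ⧸ Ideal.span {x})] {c : R} (hc : c ≠ 0)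
    {L : Type*} [AddCommGroup L] [Module R L] [Module.Finite R L]
    (hcL : ∀ m : L, c • m = 0) (hL : IsSMulRegular L x) : HasTwoTermFreeResolution R L := by
  obtain ⟨a, g, hg⟩ := Module.Finite.exists_fin' R L
  have : Module.FinitePresentation R (LinearMap.ker g) := Module.finitePresentation_of_finite _ _
  have : Module.Free R (LinearMap.ker g) := free_ker_of_isSMulRegular hx hjac hL g
  let φ : (Fin a → R) →ₗ[R] LinearMap.ker g :=
    (c • LinearMap.id).codRestrict _ fun v ↦ by simp [hcL]
  have hφ : Function.Injective φ := fun v w h ↦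
    smul_right_injective (Fin a → R) hc (congr_arg Subtype.val h)
  have hrank : Module.finrank R (LinearMap.ker g) = a := by
    refine le_antisymm ?_ ?_
    · simpa using LinearMap.finrank_le_finrank_of_injective
        (LinearMap.ker g).injective_subtype
    · simpa using LinearMap.finrank_le_finrank_of_injective hφ
  let e : (Fin a → R) ≃ₗ[R] LinearMap.ker g :=
    (Module.finBasisOfFinrankEq R (LinearMap.ker g) hrank).equivFun.symm
  refine ⟨a, (LinearMap.ker g).subtype ∘ₗ e.toLinearMap, g,
    (LinearMap.ker g).injective_subtype.comp e.injective, hg, ?_⟩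
  rw [LinearMap.range_comp, LinearEquiv.range, Submodule.map_top, Submodule.range_subtype]

/-- A module killed by `c` with a two-term finite free resolution has no `x`-torsion, for every
prime `x` not dividing `c`. -/
theorem HasTwoTermFreeResolution.isSMulRegular {R : Type*} [CommRing R] [IsDomain R]
    {x c : R} (hx : Prime x) (hxc : ¬ x ∣ c) {L : Type*} [AddCommGroup L] [Module R L]
    (hcL : ∀ m : L, c • m = 0) (h : HasTwoTermFreeResolution R L) : IsSMulRegular L x := by
  obtain ⟨a, f, g, hf, hg, hfg⟩ := h
  refine isSMulRegular_iff_right_eq_zero_of_smul.2 fun m hm ↦ ?_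
  obtain ⟨v, rfl⟩ := hg m
  obtain ⟨y, hy⟩ : x • v ∈ LinearMap.range f := by rw [hfg]; simpa using hm
  obtain ⟨w, hw⟩ : c • v ∈ LinearMap.range f := by rw [hfg]; simpa using hcL (g v)
  have hyw : x • w = c • y := hf (by rw [map_smul, map_smul, hw, hy, smul_comm])
  have hdvd (i : Fin a) : x ∣ y i :=
    (hx.dvd_or_dvd (show x ∣ c * y i from ⟨w i, (congr_fun hyw i).symm⟩)).resolve_left hxc
  choose z hz using hdvd
  have hyz : y = x • z := funext hz
  have hv : f z = v := smul_right_injective (Fin a → R) hx.ne_zero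
    (show x • f z = x • v by rw [← map_smul, ← hyz, hy])
  have : v ∈ LinearMap.ker g := hfg ▸ ⟨z, hv⟩
  exact this

theorem PowerSeries.isPrincipalIdealRing_quotient_span_X (A : Type*) [CommRing A]
    [IsPrincipalIdealRing A] :
    IsPrincipalIdealRing (PowerSeries A ⧸ Ideal.span {(PowerSeries.X : PowerSeries A)}) := by
  refine IsPrincipalIdealRing.of_surjective
    ((Ideal.Quotient.mk (Ideal.span {(PowerSeries.X : PowerSeries A)})).comp PowerSeries.C)
    fun q ↦ ?_
  obtain ⟨φ, rfl⟩ := Ideal.Quotient.mk_surjective q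
  refine ⟨PowerSeries.constantCoeff φ, Ideal.Quotient.eq.2 ?_⟩
  rw [Ideal.mem_span_singleton, PowerSeries.X_dvd_iff]
  simp

theorem PowerSeries.X_mem_jacobson_bot (A : Type*) [CommRing A] :
    (PowerSeries.X : PowerSeries A) ∈ (⊥ : Ideal (PowerSeries A)).jacobson := by
  rw [Ideal.mem_jacobson_bot]
  intro φ
  simp [PowerSeries.isUnit_iff_constantCoeff]

/-- Let `p` be a prime, `k` a perfect field of characteristic `p`, `𝔖 = W(k)[[u]]`,
and `M` a finitely generated `𝔖`-module killed by `p ^ n` (`n > 0`) which admits a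
resolution `0 → 𝔖^d → 𝔖^d → M → 0`.  A submodule `N ⊆ M` is saturated
(i.e. `u • m ∈ N → m ∈ N`) if and only if both `N` and `M/N` admit two-term
finite free resolutions. -/
theorem saturated_iff_twoTermFreeResolutions
    (p : ℕ) [Fact p.Prime] (k : Type*) [Field k] [CharP k p] [PerfectRing k p]
    (n : ℕ) (hn : 0 < n)
    (M : Type*) [AddCommGroup M] [Module (PowerSeries (WittVector p k)) M]
    [Module.Finite (PowerSeries (WittVector p k)) M]
    (hkill : ∀ m : M, (p : PowerSeries (WittVector p k)) ^ n • m = 0)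
    (hres : HasTwoTermFreeResolution (PowerSeries (WittVector p k)) M)
    (N : Submodule (PowerSeries (WittVector p k)) M) :
    (∀ m : M, (PowerSeries.X : PowerSeries (WittVector p k)) • m ∈ N → m ∈ N) ↔
      (HasTwoTermFreeResolution (PowerSeries (WittVector p k)) N ∧
        HasTwoTermFreeResolution (PowerSeries (WittVector p k)) (M ⧸ N)) := by
  have := PowerSeries.isPrincipalIdealRing_quotient_span_X (WittVector p k)
  have hX : Prime (PowerSeries.X : PowerSeries (WittVector p k)) := PowerSeries.X_prime
  have hjac := PowerSeries.X_mem_jacobson_bot (WittVector p k)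
  have hXp : ¬ (PowerSeries.X : PowerSeries (WittVector p k)) ∣
      (p : PowerSeries (WittVector p k)) ^ n := by
    rw [PowerSeries.X_dvd_iff, map_pow, map_natCast]
    exact pow_ne_zero n (WittVector.irreducible p).ne_zero
  have hp : (p : PowerSeries (WittVector p k)) ^ n ≠ 0 := fun h ↦ hXp (h ▸ dvd_zero _)
  have hkillQ (m : M ⧸ N) : (p : PowerSeries (WittVector p k)) ^ n • m = 0 := by
    obtain ⟨m, rfl⟩ := Submodule.Quotient.mk_surjective _ m
    rw [← Submodule.Quotient.mk_smul, hkill, Submodule.Quotient.mk_zero]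
  have hsat : (∀ m : M, (PowerSeries.X : PowerSeries (WittVector p k)) • m ∈ N → m ∈ N) ↔
      IsSMulRegular (M ⧸ N) (PowerSeries.X : PowerSeries (WittVector p k)) := by
    rw [isSMulRegular_iff_right_eq_zero_of_smul, (Submodule.Quotient.mk_surjective N).forall]
    simp only [← Submodule.Quotient.mk_smul, Submodule.Quotient.mk_eq_zero]
  rw [hsat]
  refine ⟨fun h ↦ ⟨?_, .of_isSMulRegular hX hjac hp hkillQ h⟩,
    fun h ↦ h.2.isSMulRegular hX hXp hkillQ⟩
  exact .of_isSMulRegular hX hjac hp (fun m ↦ Subtype.ext (hkill m))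
    (.of_injective N.subtype N.injective_subtype (hres.isSMulRegular hX hXp hkill))
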